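/- Let σ > 0, θ > 0, and let r : ℤ → ℝ satisfy r(0) = 1, r(−k) = r(k), Σ_k |r(k)| < ∞, with spectral density f_s(ω) = Σ_{k∈ℤ} r(k)e^{−ikω} satisfying 0 ≤ f_s(ω) ≤ M for all ω, and suppose each Toeplitz matrix Σ_{s,n} = (r(i−j))_{1≤i,j≤n} is positive semidefinite. Let Q_n = σ⁻²I − (σ²I + θ²Σ_{s,n})⁻¹ and define the optimal test statistic T_{o,n}(y) = (1/n)[(1/2)·log(det(σ²I)/det(σ²I+θ²Σ_{s,n})) + (1/2)·yᵀQ_n y]. For each n let y_n ~ N(0, σ²I) (hypothesis H₀). Then for every real t with t·θ²M/(σ²+θ²M) < 1, lim_{n→∞} (1/n)·log E[exp(n·t·T_{o,n}(y_n))] = (t/4π)∫₀^{2π} log(σ²/(σ²+θ²f_s(ω))) dω − (1/4π)∫₀^{2π} log(1 − t·θ²f_s(ω)/(σ²+θ²f_s(ω))) dω. -/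

import Mathlib

open MeasureTheory Matrix ProbabilityTheory Filter Topology

lemma integral_exp_mul_sq_gaussianReal {c : ℝ} (hc : c < 1 / 2) :
    ∫ x, Real.exp (c * x ^ 2) ∂(gaussianReal 0 1) = (√(1 - 2 * c))⁻¹ := by
  rw [integral_gaussianReal_eq_integral_smul one_ne_zero]
  have h : ∀ x : ℝ, gaussianPDFReal 0 1 x • Real.exp (c * x ^ 2)
      = (√(2 * Real.pi))⁻¹ * Real.exp (-(1 / 2 - c) * x ^ 2) := by
    intro x
    rw [gaussianPDFReal_def, smul_eq_mul]
    simp only [NNReal.coe_one, mul_one, sub_zero]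
    rw [mul_assoc, ← Real.exp_add]
    congr 2
    ring
  simp_rw [h]
  rw [integral_const_mul, integral_gaussian, ← Real.sqrt_inv, ← Real.sqrt_inv,
    ← Real.sqrt_mul (by positivity)]
  congr 1
  have : 1 / 2 - c ≠ 0 := by linarith
  have : 1 - 2 * c ≠ 0 := by linarith
  have := Real.pi_ne_zero
  field_simp

lemma integral_exp_quadratic_pi_gaussianReal {n : ℕ}
    (b : OrthonormalBasis (Fin n) ℝ (EuclideanSpace ℝ (Fin n)))
    (B : Matrix (Fin n) (Fin n) ℝ) (q : Fin n → ℝ)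
    (hB : ∀ i, B *ᵥ ⇑(b i) = q i • ⇑(b i)) (hq : ∀ i, q i < 1 / 2) :
    ∫ y, Real.exp (y ⬝ᵥ B *ᵥ y) ∂(Measure.pi fun _ : Fin n => gaussianReal 0 1)
      = ∏ i, (√(1 - 2 * q i))⁻¹ := by
  have hcont : Continuous fun x : EuclideanSpace ℝ (Fin n) =>
      Real.exp (⇑x ⬝ᵥ B *ᵥ ⇑x) := by fun_prop
  have h1 : ∫ y, Real.exp (y ⬝ᵥ B *ᵥ y) ∂(Measure.pi fun _ : Fin n => gaussianReal 0 1)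
      = ∫ x, Real.exp (⇑x ⬝ᵥ B *ᵥ ⇑x) ∂(stdGaussian (EuclideanSpace ℝ (Fin n))) := by
    rw [← map_pi_eq_stdGaussian, integral_map (by fun_prop) hcont.aestronglyMeasurable]
  have h2 : ∀ x : Fin n → ℝ, ⇑(∑ i, x i • b i) ⬝ᵥ B *ᵥ ⇑(∑ i, x i • b i)
      = ∑ i, q i * x i ^ 2 := by
    intro x
    have e1 : B *ᵥ ⇑(∑ i, x i • b i) = ⇑(∑ i, (q i * x i) • b i) := by
      simp only [WithLp.ofLp_sum, WithLp.ofLp_smul, Matrix.mulVec_sum, Matrix.mulVec_smul, hB,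
        smul_smul, mul_comm]
    have e2 : ∀ u v : EuclideanSpace ℝ (Fin n), ⇑u ⬝ᵥ ⇑v = inner ℝ u v := by
      intro u v
      rw [EuclideanSpace.inner_eq_star_dotProduct, star_trivial, dotProduct_comm]
    rw [e1, e2, Orthonormal.inner_sum b.orthonormal]
    refine Finset.sum_congr rfl fun i _ => ?_
    simp only [conj_trivial]
    ring
  have hmap : Measurable fun x : Fin n → ℝ => ∑ i, x i • b i := by fun_prop
  rw [h1, stdGaussian_eq_map_pi_orthonormalBasis b,
    integral_map hmap.aemeasurable hcont.aestronglyMeasurable]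
  simp_rw [h2, Real.exp_sum]
  rw [integral_fintype_prod_eq_prod (fun i x => Real.exp (q i * x ^ 2))]
  exact Finset.prod_congr rfl fun i _ => integral_exp_mul_sq_gaussianReal (hq i)

lemma pi_gaussianReal_sq_eq_map (n : ℕ) (σ : ℝ) :
    (Measure.pi fun _ : Fin n => gaussianReal 0 ⟨σ ^ 2, sq_nonneg σ⟩)
      = (Measure.pi fun _ : Fin n => gaussianReal 0 1).map (fun y => σ • y) := by
  have h : gaussianReal 0 ⟨σ ^ 2, sq_nonneg σ⟩ = (gaussianReal 0 1).map (σ * ·) := by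
    rw [gaussianReal_map_const_mul, mul_zero, mul_one]; rfl
  simp_rw [h]
  rw [← Measure.pi_map_pi (fun i => by fun_prop)]
  rfl

lemma integral_exp_quadratic_pi_gaussianReal_sq {n : ℕ} (σ : ℝ)
    (b : OrthonormalBasis (Fin n) ℝ (EuclideanSpace ℝ (Fin n)))
    (B : Matrix (Fin n) (Fin n) ℝ) (q : Fin n → ℝ) (c : ℝ)
    (hB : ∀ i, B *ᵥ ⇑(b i) = q i • ⇑(b i)) (hq : ∀ i, 2 * c * σ ^ 2 * q i < 1) :
    ∫ y, Real.exp (c * (y ⬝ᵥ B *ᵥ y))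
        ∂(Measure.pi fun _ : Fin n => gaussianReal 0 ⟨σ ^ 2, sq_nonneg σ⟩)
      = ∏ i, (√(1 - 2 * c * σ ^ 2 * q i))⁻¹ := by
  have hcont : Continuous fun x : Fin n → ℝ => Real.exp (c * (x ⬝ᵥ B *ᵥ x)) := by fun_prop
  rw [pi_gaussianReal_sq_eq_map, integral_map (by fun_prop) hcont.aestronglyMeasurable]
  have h := integral_exp_quadratic_pi_gaussianReal b ((c * σ ^ 2) • B)
    (fun i => c * σ ^ 2 * q i)
    (fun i => by rw [Matrix.smul_mulVec, hB, smul_smul]) (fun i => by linarith [hq i])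
  convert h using 4 with y i y
  · simp only [Matrix.mulVec_smul, Matrix.smul_mulVec, dotProduct_smul, smul_dotProduct,
      smul_eq_mul]
    ring
  · ring

namespace Matrix.IsHermitian

variable {n : ℕ} {A : Matrix (Fin n) (Fin n) ℝ} (hA : A.IsHermitian)
include hA

lemma trace_pow_eq_sum_eigenvalues_pow (k : ℕ) :
    (A ^ k).trace = ∑ i, hA.eigenvalues i ^ k := by
  conv_lhs => rw [hA.spectral_theorem, ← map_pow, Unitary.conjStarAlgAut_apply,
    Matrix.trace_mul_cycle]
  simp [Matrix.diagonal_pow, Matrix.trace_diagonal]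

lemma det_smul_one_add_smul (s t : ℝ) :
    (s • (1 : Matrix (Fin n) (Fin n) ℝ) + t • A).det = ∏ i, (s + t * hA.eigenvalues i) := by
  have h : s • (1 : Matrix (Fin n) (Fin n) ℝ) + t • A
      = Unitary.conjStarAlgAut ℝ _ hA.eigenvectorUnitary
        (diagonal fun i => s + t * hA.eigenvalues i) := by
    conv_lhs => rw [hA.spectral_theorem, ← map_smul,
      ← map_one (Unitary.conjStarAlgAut ℝ _ hA.eigenvectorUnitary), ← map_smul, ← map_add]
    congr 1
    ext i j
    by_cases hij : i = j <;> simp [hij]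
  rw [h, Unitary.conjStarAlgAut_apply, Matrix.det_mul_comm, ← Matrix.mul_assoc]
  simp

end Matrix.IsHermitian

lemma Matrix.inv_mulVec_of_eigenvector {n : ℕ} {S : Matrix (Fin n) (Fin n) ℝ}
    (hS : IsUnit S.det) {v : Fin n → ℝ} {s : ℝ} (hs : s ≠ 0) (hv : S *ᵥ v = s • v) :
    S⁻¹ *ᵥ v = s⁻¹ • v := by
  have h : v = s⁻¹ • (S *ᵥ v) := by rw [hv, smul_smul, inv_mul_cancel₀ hs, one_smul]
  conv_lhs => rw [h, Matrix.mulVec_smul, Matrix.mulVec_mulVec, Matrix.nonsing_inv_mul _ hS,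
    Matrix.one_mulVec]

/-- Convergence of all moments on a compact interval implies convergence of the averages of
every continuous function. -/
lemma tendsto_average_of_tendsto_moments {M : ℝ} (lam : (n : ℕ) → Fin n → ℝ)
    (hlam : ∀ n i, lam n i ∈ Set.Icc 0 M) {f : ℝ → ℝ} (hfc : Continuous f)
    (hfM : ∀ ω, f ω ∈ Set.Icc 0 M)
    (hmom : ∀ k : ℕ, Tendsto (fun n : ℕ => (1 / (n : ℝ)) * ∑ i, lam n i ^ k) atTop
      (𝓝 ((1 / (2 * Real.pi)) * ∫ ω in (0 : ℝ)..(2 * Real.pi), f ω ^ k)))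
    {F : ℝ → ℝ} (hF : ContinuousOn F (Set.Icc 0 M)) :
    Tendsto (fun n : ℕ => (1 / (n : ℝ)) * ∑ i, F (lam n i)) atTop
      (𝓝 ((1 / (2 * Real.pi)) * ∫ ω in (0 : ℝ)..(2 * Real.pi), F (f ω))) := by
  have hpoly : ∀ p : Polynomial ℝ, Tendsto (fun n : ℕ => (1 / (n : ℝ)) * ∑ i, p.eval (lam n i))
      atTop (𝓝 ((1 / (2 * Real.pi)) * ∫ ω in (0 : ℝ)..(2 * Real.pi), p.eval (f ω))) := by
    intro p
    induction p using Polynomial.induction_on' with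
    | add p q hp hq =>
      have hint : ∀ p : Polynomial ℝ, IntervalIntegrable (fun ω => p.eval (f ω)) volume 0
          (2 * Real.pi) := fun p => (p.continuous.comp hfc).intervalIntegrable _ _
      simp only [Polynomial.eval_add, Finset.sum_add_distrib, mul_add]
      rw [intervalIntegral.integral_add (hint p) (hint q), mul_add]
      exact hp.add hq
    | monomial k a =>
      simp only [Polynomial.eval_monomial, ← Finset.mul_sum, mul_left_comm _ a]
      rw [intervalIntegral.integral_const_mul, mul_left_comm]
      exact (hmom k).const_mul a
  have hFf : Continuous fun ω => F (f ω) :=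
    hF.comp_continuous hfc hfM
  rw [Metric.tendsto_atTop]
  intro ε hε
  obtain ⟨p, hp⟩ := exists_polynomial_near_of_continuousOn 0 M F hF (ε / 4) (by positivity)
  obtain ⟨N, hN⟩ := Metric.tendsto_atTop.1 (hpoly p) (ε / 4) (by positivity)
  refine ⟨max N 1, fun n hn => ?_⟩
  have hn1 : (0 : ℝ) < n := by exact_mod_cast (le_max_right N 1).trans hn
  have h1 := hN n ((le_max_left N 1).trans hn)
  have h2 : |(1 / (n : ℝ)) * ∑ i, p.eval (lam n i) - (1 / (n : ℝ)) * ∑ i, F (lam n i)|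
      ≤ ε / 4 := by
    rw [← mul_sub, ← Finset.sum_sub_distrib, abs_mul, abs_of_pos (by positivity : 1 / (n : ℝ) > 0)]
    calc (1 / (n : ℝ)) * |∑ i, (p.eval (lam n i) - F (lam n i))|
        ≤ (1 / (n : ℝ)) * ∑ _i : Fin n, ε / 4 := by
          gcongr
          exact (Finset.abs_sum_le_sum_abs _ _).trans
            (Finset.sum_le_sum fun i _ => (hp _ (hlam n i)).le)
      _ = ε / 4 := by
          rw [Finset.sum_const, Finset.card_univ, Fintype.card_fin, nsmul_eq_mul]
          field_simp
  have h3 : |(1 / (2 * Real.pi)) * (∫ ω in (0 : ℝ)..(2 * Real.pi), p.eval (f ω))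
      - (1 / (2 * Real.pi)) * ∫ ω in (0 : ℝ)..(2 * Real.pi), F (f ω)| ≤ ε / 4 := by
    have hpi := Real.pi_pos
    have hpf : Continuous fun ω => p.eval (f ω) := p.continuous.comp hfc
    rw [← mul_sub, ← intervalIntegral.integral_sub
      (hpf.intervalIntegrable _ _) (hFf.intervalIntegrable _ _), abs_mul,
      abs_of_pos (by positivity : 1 / (2 * Real.pi) > 0)]
    have := intervalIntegral.norm_integral_le_of_norm_le_const (a := 0) (b := 2 * Real.pi)
      (f := fun ω => p.eval (f ω) - F (f ω)) (C := ε / 4) (fun ω _ => (hp _ (hfM ω)).le)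
    rw [Real.norm_eq_abs, sub_zero, abs_of_pos (by positivity : 2 * Real.pi > 0)] at this
    calc _ ≤ (1 / (2 * Real.pi)) * (ε / 4 * (2 * Real.pi)) := by gcongr
      _ = ε / 4 := by field_simp
  rw [Real.dist_eq] at h1 ⊢
  rw [abs_lt] at h1 ⊢
  rw [abs_le] at h2 h3
  constructor <;> linarith [h1.1, h1.2, h2.1, h2.2, h3.1, h3.2]

/-- The number of rows `i < n` of an `n × n` matrix for which column `i - m` does not exist. -/
def missingColumnCount (n : ℕ) (m : ℤ) : ℕ :=
  (Finset.univ.filter fun i : Fin n => ¬ (0 ≤ (i : ℤ) - m ∧ (i : ℤ) - m < n)).card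

lemma missingColumnCount_le_size (n : ℕ) (m : ℤ) : missingColumnCount n m ≤ n :=
  (Finset.card_filter_le _ _).trans_eq (by simp)

lemma missingColumnCount_le_natAbs (n : ℕ) (m : ℤ) : missingColumnCount n m ≤ m.natAbs := by
  rw [missingColumnCount, ← Finset.card_map Fin.valEmbedding]
  rcases le_total 0 m with hm | hm
  · refine (Finset.card_le_card (t := Finset.range m.natAbs) ?_).trans_eq (by simp)
    intro i
    simp only [Finset.mem_map, Finset.mem_filter, Finset.mem_univ, true_and, Finset.mem_range]
    rintro ⟨j, hj, rfl⟩
    simp only [Fin.valEmbedding_apply]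
    omega
  · refine (Finset.card_le_card (t := Finset.Ico (n - m.natAbs) n) ?_).trans ?_
    · intro i
      simp only [Finset.mem_map, Finset.mem_filter, Finset.mem_univ, true_and, Finset.mem_Ico]
      rintro ⟨j, hj, rfl⟩
      simp only [Fin.valEmbedding_apply]
      omega
    · simp only [Nat.card_Ico]
      omega

/-- The total mass of the coefficients cut off by truncating the Laurent matrix of `r` to an
`n × n` Toeplitz matrix. -/
noncomputable def truncationError (r : ℤ → ℝ) (n : ℕ) : ℝ :=
  ∑ i : Fin n, ∑' m : ℤ, if 0 ≤ (i : ℤ) - m ∧ (i : ℤ) - m < n then 0 else |r m|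

lemma tendsto_truncationError_div {r : ℤ → ℝ} (hsum : Summable fun k => |r k|) :
    Tendsto (fun n : ℕ => (1 / (n : ℝ)) * truncationError r n) atTop (𝓝 0) := by
  have h : ∀ n : ℕ, (1 / (n : ℝ)) * truncationError r n
      = ∑' m : ℤ, (missingColumnCount n m / n : ℝ) * |r m| := by
    intro n
    rw [truncationError, ← Summable.tsum_finsetSum, ← tsum_mul_left]
    · refine tsum_congr fun m => ?_
      rw [missingColumnCount, Finset.sum_ite, Finset.sum_const_zero, zero_add,
        Finset.sum_const, nsmul_eq_mul]
      ring
    · intro i _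
      refine hsum.of_norm_bounded fun m => ?_
      split_ifs <;> simp
  simp_rw [h]
  rw [show (0 : ℝ) = ∑' _ : ℤ, (0 : ℝ) by simp]
  refine tendsto_tsum_of_dominated_convergence hsum (fun m => ?_) (Eventually.of_forall ?_)
  · rw [← zero_mul |r m|]
    refine Tendsto.mul_const _ ?_
    refine squeeze_zero (fun n => by positivity) (fun n => ?_)
      (tendsto_const_div_atTop_nhds_zero_nat (m.natAbs : ℝ))
    gcongr
    exact missingColumnCount_le_natAbs n m
  · intro n m
    rw [Real.norm_eq_abs, abs_mul, abs_abs]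
    refine mul_le_of_le_one_left (abs_nonneg _) ?_
    rw [abs_of_nonneg (by positivity)]
    exact div_le_one_of_le₀ (by exact_mod_cast missingColumnCount_le_size n m) (by positivity)

/-- The character `ω ↦ e^{imω}`. -/
noncomputable def expChar (m : ℤ) (ω : ℝ) : ℂ := Complex.exp (Complex.I * m * ω)

@[fun_prop] lemma continuous_expChar (m : ℤ) : Continuous (expChar m) := by
  unfold expChar; fun_prop

@[simp] lemma norm_expChar (m : ℤ) (ω : ℝ) : ‖expChar m ω‖ = 1 := by
  rw [expChar, show Complex.I * m * ω = ((m * ω : ℝ) : ℂ) * Complex.I by push_cast; ring]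
  exact Complex.norm_exp_ofReal_mul_I _

@[simp] lemma expChar_zero (ω : ℝ) : expChar 0 ω = 1 := by simp [expChar]

lemma expChar_add (m k : ℤ) (ω : ℝ) : expChar (m + k) ω = expChar m ω * expChar k ω := by
  rw [expChar, expChar, expChar, ← Complex.exp_add]
  congr 1; push_cast; ring

lemma conj_expChar (m : ℤ) (ω : ℝ) : (starRingEnd ℂ) (expChar m ω) = expChar (-m) ω := by
  rw [expChar, expChar, ← Complex.exp_conj]
  simp

lemma integral_expChar (m : ℤ) :
    ∫ ω in (0 : ℝ)..(2 * Real.pi), expChar m ω = if m = 0 then (2 * Real.pi : ℂ) else 0 := by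
  split_ifs with h
  · subst h; simp
  · have hm : Complex.I * (m : ℂ) ≠ 0 := by simp [h]
    simp only [expChar]
    rw [integral_exp_mul_complex hm]
    have : Complex.exp (Complex.I * m * ((2 * Real.pi : ℝ) : ℂ)) = 1 := by
      rw [Complex.exp_eq_one_iff]
      exact ⟨m, by push_cast; ring⟩
    rw [this]; simp

section Symbol

variable {r : ℤ → ℝ} {f : ℝ → ℝ} (hsum : Summable fun k => |r k|)
  (hf : ∀ ω : ℝ, (f ω : ℂ) = ∑' k : ℤ, (r k : ℂ) * expChar (-k) ω)
include hsum

lemma summable_mul_expChar (s : ℤ → ℤ) (ω : ℝ) :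
    Summable fun k : ℤ => (r k : ℂ) * expChar (s k) ω :=
  hsum.of_norm_bounded fun k => by simp

include hf

lemma continuous_symbol : Continuous f := by
  have h : Continuous fun ω => (f ω : ℂ) := by
    simp_rw [hf]
    exact continuous_tsum (fun k => continuous_const.mul (continuous_expChar _)) hsum
      (fun k ω => by simp)
  exact Complex.continuous_re.comp h

lemma integral_symbol_mul_expChar (m : ℤ) :
    ∫ ω in (0 : ℝ)..(2 * Real.pi), (f ω : ℂ) * expChar m ω = 2 * Real.pi * r m := by
  let F : ℤ → C(ℝ, ℂ) := fun k =>
    ⟨fun ω => (r k : ℂ) * expChar (-k + m) ω, continuous_const.mul (continuous_expChar _)⟩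
  have hF := intervalIntegral.hasSum_intervalIntegral_of_summable_norm (a := 0)
    (b := 2 * Real.pi) (f := F) (hsum.of_nonneg_of_le (fun _ => norm_nonneg _) fun k => by
      rw [ContinuousMap.norm_le _ (abs_nonneg _)]
      intro x
      simp [F])
  have h1 : ∀ ω, (f ω : ℂ) * expChar m ω = ∑' k, F k ω := fun ω => by
    simp only [F, ContinuousMap.coe_mk, expChar_add, ← mul_assoc]
    rw [tsum_mul_right, hf]
  simp_rw [h1]
  rw [← hF.tsum_eq]
  simp only [F, ContinuousMap.coe_mk, intervalIntegral.integral_const_mul, integral_expChar]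
  rw [tsum_eq_single m]
  · simp [mul_comm]
  · intro k hk
    rw [if_neg (by omega), mul_zero]

end Symbol

/-- The `n × n` Toeplitz matrix of a sequence. -/
abbrev toeplitzMatrix (r : ℤ → ℝ) (n : ℕ) : Matrix (Fin n) (Fin n) ℝ :=
  Matrix.of fun i j : Fin n => r ((i.val : ℤ) - (j.val : ℤ))

section Toeplitz

variable {r : ℤ → ℝ} {f : ℝ → ℝ} (hsum : Summable fun k => |r k|)
  (hf : ∀ ω : ℝ, (f ω : ℂ) = ∑' k : ℤ, (r k : ℂ) * expChar (-k) ω)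
include hsum hf

lemma dotProduct_toeplitzMatrix_mulVec {n : ℕ} (x : Fin n → ℝ) :
    2 * Real.pi * (x ⬝ᵥ toeplitzMatrix r n *ᵥ x)
      = ∫ ω in (0 : ℝ)..(2 * Real.pi), f ω * ‖∑ i : Fin n, x i * expChar i ω‖ ^ 2 := by
  have hfc := continuous_symbol hsum hf
  have key : ∀ ω, (((f ω * ‖∑ i : Fin n, x i * expChar i ω‖ ^ 2 : ℝ)) : ℂ)
      = ∑ i : Fin n, ∑ j : Fin n, ((x i * x j : ℝ) : ℂ) * (f ω * expChar (i - j) ω) := by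
    intro ω
    push_cast
    rw [← Complex.mul_conj', map_sum, Finset.sum_mul_sum, Finset.mul_sum]
    refine Finset.sum_congr rfl fun i _ => ?_
    rw [Finset.mul_sum]
    refine Finset.sum_congr rfl fun j _ => ?_
    rw [map_mul, conj_expChar, Complex.conj_ofReal, sub_eq_add_neg, expChar_add]
    ring
  apply Complex.ofReal_injective
  rw [← intervalIntegral.integral_ofReal]
  simp_rw [key]
  have hcont : ∀ i j : Fin n, Continuous fun ω : ℝ =>
      ((x i * x j : ℝ) : ℂ) * (f ω * expChar (i - j) ω) := fun i j =>
    continuous_const.mul ((Complex.continuous_ofReal.comp hfc).mul (continuous_expChar _))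
  rw [intervalIntegral.integral_finsetSum fun i _ =>
    (continuous_finsetSum _ fun j _ => hcont i j).intervalIntegrable _ _]
  simp only [dotProduct, Matrix.mulVec, Matrix.of_apply, Finset.mul_sum, Complex.ofReal_sum]
  refine Finset.sum_congr rfl fun i _ => ?_
  rw [intervalIntegral.integral_finsetSum fun j _ => (hcont i j).intervalIntegrable _ _]
  refine Finset.sum_congr rfl fun j _ => ?_
  rw [intervalIntegral.integral_const_mul, integral_symbol_mul_expChar hsum hf]
  push_cast
  ring

end Toeplitz

lemma dotProduct_self_eq_integral {n : ℕ} (x : Fin n → ℝ) :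
    2 * Real.pi * (x ⬝ᵥ x)
      = ∫ ω in (0 : ℝ)..(2 * Real.pi), ‖∑ i : Fin n, x i * expChar i ω‖ ^ 2 := by
  have hs : Summable fun k : ℤ => |(Pi.single 0 1 : ℤ → ℝ) k| :=
    summable_of_ne_finset_zero (s := {0}) fun k hk => by
      rw [Pi.single_eq_of_ne (by simpa using hk), abs_zero]
  have hone : toeplitzMatrix (Pi.single 0 1) n = 1 := by
    ext i j
    simp [Pi.single_apply, Matrix.one_apply, sub_eq_zero, Fin.ext_iff]
  have h := dotProduct_toeplitzMatrix_mulVec (f := fun _ => 1) hs (fun ω => by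
    rw [tsum_eq_single 0 (fun k hk => by simp [Pi.single_eq_of_ne hk])]; simp) x
  rw [hone, Matrix.one_mulVec] at h
  simpa using h

lemma dotProduct_toeplitzMatrix_mulVec_le {r : ℤ → ℝ} {f : ℝ → ℝ}
    (hsum : Summable fun k => |r k|)
    (hf : ∀ ω : ℝ, (f ω : ℂ) = ∑' k : ℤ, (r k : ℂ) * expChar (-k) ω)
    {M : ℝ} (hM : ∀ ω, f ω ≤ M) {n : ℕ} (x : Fin n → ℝ) :
    x ⬝ᵥ toeplitzMatrix r n *ᵥ x ≤ M * (x ⬝ᵥ x) := by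
  have hpi : 0 < 2 * Real.pi := by positivity
  have hfc := continuous_symbol hsum hf
  have hp : Continuous fun ω => ‖∑ i : Fin n, x i * expChar i ω‖ ^ 2 := by
    fun_prop
  refine le_of_mul_le_mul_left ?_ hpi
  rw [mul_left_comm, dotProduct_toeplitzMatrix_mulVec hsum hf, dotProduct_self_eq_integral,
    ← intervalIntegral.integral_const_mul]
  exact intervalIntegral.integral_mono_on hpi.le ((hfc.mul hp).intervalIntegrable _ _)
    ((continuous_const.mul hp).intervalIntegrable _ _)
    fun ω _ => mul_le_mul_of_nonneg_right (hM ω) (by positivity)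

lemma eigenvalues_toeplitzMatrix_le {r : ℤ → ℝ} {f : ℝ → ℝ}
    (hsum : Summable fun k => |r k|)
    (hf : ∀ ω : ℝ, (f ω : ℂ) = ∑' k : ℤ, (r k : ℂ) * expChar (-k) ω)
    {M : ℝ} (hM : ∀ ω, f ω ≤ M) {n : ℕ} (hA : (toeplitzMatrix r n).IsHermitian) (i : Fin n) :
    hA.eigenvalues i ≤ M := by
  have h := dotProduct_toeplitzMatrix_mulVec_le hsum hf hM ⇑(hA.eigenvectorBasis i)
  have h1 : ⇑(hA.eigenvectorBasis i) ⬝ᵥ ⇑(hA.eigenvectorBasis i) = (1 : ℝ) := by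
    have := real_inner_self_eq_norm_sq (hA.eigenvectorBasis i)
    rwa [EuclideanSpace.inner_eq_star_dotProduct, star_trivial,
      hA.eigenvectorBasis.orthonormal.1 i, one_pow] at this
  rwa [hA.mulVec_eigenvectorBasis, dotProduct_smul, h1, smul_eq_mul, mul_one, mul_one] at h

lemma integral_expChar_quadratic {n : ℕ} (B : Matrix (Fin n) (Fin n) ℝ) :
    ∫ ω in (0 : ℝ)..(2 * Real.pi), ∑ i : Fin n, expChar (-i) ω *
        (B.map Complex.ofReal *ᵥ fun j : Fin n => expChar j ω) i
      = ((2 * Real.pi * B.trace : ℝ) : ℂ) := by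
  have hcont : ∀ i j : Fin n, Continuous fun ω : ℝ => (B i j : ℂ) * expChar (-i + j) ω :=
    fun i j => continuous_const.mul (continuous_expChar _)
  have h : ∀ ω, ∑ i : Fin n, expChar (-i) ω *
        (B.map Complex.ofReal *ᵥ fun j : Fin n => expChar j ω) i
      = ∑ i : Fin n, ∑ j : Fin n, (B i j : ℂ) * expChar (-i + j) ω := by
    intro ω
    refine Finset.sum_congr rfl fun i _ => ?_
    simp only [Matrix.mulVec, dotProduct, Matrix.map_apply, Finset.mul_sum, expChar_add]
    exact Finset.sum_congr rfl fun j _ => by ring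
  simp_rw [h]
  rw [intervalIntegral.integral_finsetSum fun i _ =>
    (continuous_finsetSum _ fun j _ => hcont i j).intervalIntegrable _ _, Matrix.trace]
  push_cast
  rw [Finset.mul_sum]
  refine Finset.sum_congr rfl fun i _ => ?_
  rw [intervalIntegral.integral_finsetSum fun j _ => (hcont i j).intervalIntegrable _ _,
    Finset.sum_eq_single i]
  · rw [intervalIntegral.integral_const_mul, integral_expChar]
    simp [mul_comm]
  · intro j _ hj
    rw [intervalIntegral.integral_const_mul, integral_expChar, if_neg, mul_zero]
    intro h
    exact hj (Fin.ext (by omega))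
  · simp

section Moments

variable {r : ℤ → ℝ} {f : ℝ → ℝ} (hsum : Summable fun k => |r k|)
include hsum

lemma sum_abs_toeplitzMatrix_column_le {n : ℕ} (j : Fin n) :
    ∑ i : Fin n, |r ((i.val : ℤ) - (j.val : ℤ))| ≤ ∑' k, |r k| := by
  have hinj : Function.Injective fun i : Fin n => (i.val : ℤ) - (j.val : ℤ) := by
    intro a b hab
    simp only at hab
    ext; omega
  rw [← tsum_fintype (L := SummationFilter.unconditional _)]
  exact tsum_comp_le_tsum_of_inj hsum (fun _ => abs_nonneg _) hinj

lemma sum_norm_toeplitzMatrix_mulVec_le {n : ℕ} (x : Fin n → ℂ) :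
    ∑ i, ‖((toeplitzMatrix r n).map Complex.ofReal *ᵥ x) i‖ ≤ (∑' k, |r k|) * ∑ i, ‖x i‖ := by
  calc ∑ i, ‖((toeplitzMatrix r n).map Complex.ofReal *ᵥ x) i‖
      ≤ ∑ i : Fin n, ∑ j : Fin n, |r ((i.val : ℤ) - (j.val : ℤ))| * ‖x j‖ := by
        refine Finset.sum_le_sum fun i _ => ?_
        refine (norm_sum_le Finset.univ
          fun j => (toeplitzMatrix r n).map Complex.ofReal i j * x j).trans_eq ?_
        simp
    _ = ∑ j : Fin n, (∑ i : Fin n, |r ((i.val : ℤ) - (j.val : ℤ))|) * ‖x j‖ := by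
        rw [Finset.sum_comm]
        simp_rw [Finset.sum_mul]
    _ ≤ _ := by
        rw [Finset.mul_sum]
        gcongr with j
        exact sum_abs_toeplitzMatrix_column_le hsum j

variable (hf : ∀ ω : ℝ, (f ω : ℂ) = ∑' k : ℤ, (r k : ℂ) * expChar (-k) ω)
include hf

lemma sum_norm_toeplitzMatrix_mulVec_expChar_sub_le (n : ℕ) (ω : ℝ) :
    ∑ i : Fin n, ‖((toeplitzMatrix r n).map Complex.ofReal *ᵥ fun j : Fin n => expChar j ω) i
      - f ω * expChar i ω‖ ≤ truncationError r n := by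
  refine Finset.sum_le_sum fun i _ => ?_
  let G : ℤ → ℂ := fun m => r m * expChar (i - m) ω
  let F : ℤ → ℂ := fun m => if 0 ≤ (i : ℤ) - m ∧ (i : ℤ) - m < n then G m else 0
  have hG : Summable G := summable_mul_expChar hsum _ ω
  have hFs : Summable F := hsum.of_norm_bounded fun m => by
    simp only [F, G]; split_ifs <;> simp
  have h1 : (f ω : ℂ) * expChar i ω = ∑' m, G m := by
    rw [hf, ← tsum_mul_right]
    refine tsum_congr fun m => ?_
    simp only [G]
    rw [sub_eq_neg_add, expChar_add, mul_assoc]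
  have hinj : Function.Injective fun j : Fin n => (i.val : ℤ) - (j.val : ℤ) := by
    intro a b hab
    simp only at hab
    ext; omega
  have h2 : ((toeplitzMatrix r n).map Complex.ofReal *ᵥ fun j : Fin n => expChar j ω) i
      = ∑' m, F m := by
    rw [← hinj.tsum_eq (f := F), tsum_fintype]
    · simp only [Matrix.mulVec, dotProduct, F, G]
      refine Finset.sum_congr rfl fun j _ => ?_
      rw [if_pos (by omega)]
      simp
    · intro m hm
      have hm' : 0 ≤ (i : ℤ) - m ∧ (i : ℤ) - m < n := by
        by_contra h
        exact hm (if_neg h)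
      exact ⟨⟨((i : ℤ) - m).toNat, by omega⟩, by simp only; omega⟩
  have hterm : ∀ m, ‖F m - G m‖ = if 0 ≤ (i : ℤ) - m ∧ (i : ℤ) - m < n then 0 else |r m| := by
    intro m
    simp only [F]
    split_ifs <;> simp [G]
  rw [h1, h2, ← hFs.tsum_sub hG]
  simp_rw [← hterm]
  exact norm_tsum_le_tsum_norm (hFs.sub hG).norm

lemma sum_norm_toeplitzMatrix_pow_mulVec_expChar_sub_le {M : ℝ} (hM : ∀ ω, |f ω| ≤ M) (k : ℕ) :
    ∃ K : ℝ, ∀ (n : ℕ) (ω : ℝ),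
      ∑ i : Fin n, ‖((toeplitzMatrix r n).map Complex.ofReal ^ k *ᵥ
          fun j : Fin n => expChar j ω) i - f ω ^ k * expChar i ω‖
        ≤ K * truncationError r n := by
  induction k with
  | zero => exact ⟨0, fun n ω => by simp⟩
  | succ k ih =>
    obtain ⟨K, hK⟩ := ih
    refine ⟨(∑' m, |r m|) * K + M ^ k, fun n ω => ?_⟩
    set C := (toeplitzMatrix r n).map Complex.ofReal with hC
    set v : Fin n → ℂ := fun j : Fin n => expChar j ω with hv
    have hsplit : ∀ i : Fin n, (C ^ (k + 1) *ᵥ v) i - f ω ^ (k + 1) * v i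
        = (C *ᵥ (fun i => (C ^ k *ᵥ v) i - f ω ^ k * v i)) i
          + f ω ^ k * ((C *ᵥ v) i - f ω * v i) := by
      intro i
      have : (fun i => (C ^ k *ᵥ v) i - f ω ^ k * v i) = C ^ k *ᵥ v - (f ω : ℂ) ^ k • v := by
        ext i; simp
      rw [this, Matrix.mulVec_sub, Matrix.mulVec_smul, Matrix.mulVec_mulVec, ← pow_succ']
      simp only [Pi.sub_apply, Pi.smul_apply, smul_eq_mul]
      ring
    calc ∑ i : Fin n, ‖(C ^ (k + 1) *ᵥ v) i - f ω ^ (k + 1) * v i‖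
        ≤ ∑ i : Fin n, (‖(C *ᵥ (fun i => (C ^ k *ᵥ v) i - f ω ^ k * v i)) i‖
            + |f ω| ^ k * ‖(C *ᵥ v) i - f ω * v i‖) := by
          refine Finset.sum_le_sum fun i _ => ?_
          rw [hsplit]
          refine (norm_add_le _ _).trans_eq ?_
          simp
      _ ≤ (∑' m, |r m|) * (K * truncationError r n) + M ^ k * truncationError r n := by
          rw [Finset.sum_add_distrib, ← Finset.mul_sum]
          have h0 : (0 : ℝ) ≤ ∑' m, |r m| := tsum_nonneg fun _ => abs_nonneg _
          have hM0 : 0 ≤ M := (abs_nonneg _).trans (hM 0)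
          gcongr
          · exact (sum_norm_toeplitzMatrix_mulVec_le hsum _).trans
              (mul_le_mul_of_nonneg_left (hK n ω) h0)
          · exact hM ω
          · exact sum_norm_toeplitzMatrix_mulVec_expChar_sub_le hsum hf n ω
      _ = _ := by ring

lemma tendsto_trace_toeplitzMatrix_pow {M : ℝ} (hM : ∀ ω, |f ω| ≤ M) (k : ℕ) :
    Tendsto (fun n : ℕ => (1 / (n : ℝ)) * (toeplitzMatrix r n ^ k).trace) atTop
      (𝓝 ((1 / (2 * Real.pi)) * ∫ ω in (0 : ℝ)..(2 * Real.pi), f ω ^ k)) := by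
  obtain ⟨K, hK⟩ := sum_norm_toeplitzMatrix_pow_mulVec_expChar_sub_le hsum hf hM k
  have hfc := continuous_symbol hsum hf
  have hpi : 0 < 2 * Real.pi := by positivity
  have hbound : ∀ n : ℕ, |2 * Real.pi * (toeplitzMatrix r n ^ k).trace
      - n * ∫ ω in (0 : ℝ)..(2 * Real.pi), f ω ^ k|
      ≤ K * truncationError r n * (2 * Real.pi) := by
    intro n
    have hI := integral_expChar_quadratic (toeplitzMatrix r n ^ k)
    have hmap : (toeplitzMatrix r n ^ k).map Complex.ofReal
        = (toeplitzMatrix r n).map Complex.ofReal ^ k :=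
      Matrix.map_pow (toeplitzMatrix r n) Complex.ofRealHom k
    rw [hmap] at hI
    set g : ℝ → ℂ := fun ω => ∑ i : Fin n, expChar (-i) ω *
        ((toeplitzMatrix r n).map Complex.ofReal ^ k *ᵥ fun j : Fin n => expChar j ω) i with hg
    have hgc : Continuous g := by
      simp only [hg, Matrix.mulVec, dotProduct]
      fun_prop
    have hdiff : ((2 * Real.pi * (toeplitzMatrix r n ^ k).trace
        - n * ∫ ω in (0 : ℝ)..(2 * Real.pi), f ω ^ k : ℝ) : ℂ)
        = ∫ ω in (0 : ℝ)..(2 * Real.pi), (g ω - n * (f ω : ℂ) ^ k) := by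
      rw [intervalIntegral.integral_sub (hgc.intervalIntegrable _ _)
        ((by fun_prop : Continuous fun ω => (n : ℂ) * (f ω : ℂ) ^ k).intervalIntegrable _ _),
        hI, intervalIntegral.integral_const_mul, Complex.ofReal_sub, Complex.ofReal_mul (n : ℝ),
        ← intervalIntegral.integral_ofReal]
      simp
    rw [← Real.norm_eq_abs, ← Complex.norm_real, hdiff]
    have := intervalIntegral.norm_integral_le_of_norm_le_const (a := 0) (b := 2 * Real.pi)
      (f := fun ω => g ω - n * (f ω : ℂ) ^ k) (C := K * truncationError r n) (fun ω _ => ?_)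
    · rwa [sub_zero, abs_of_pos hpi] at this
    · refine le_trans ?_ (hK n ω)
      have hn : (n : ℂ) * (f ω : ℂ) ^ k
          = ∑ i : Fin n, expChar (-i) ω * (f ω ^ k * expChar i ω) := by
        have : ∀ i : Fin n, expChar (-i) ω * (f ω ^ k * expChar i ω) = (f ω : ℂ) ^ k := by
          intro i
          rw [mul_left_comm, ← expChar_add, neg_add_cancel, expChar_zero, mul_one]
        simp [this]
      rw [hn, hg, ← Finset.sum_sub_distrib]
      refine (norm_sum_le _ _).trans_eq (Finset.sum_congr rfl fun i _ => ?_)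
      rw [← mul_sub, norm_mul, norm_expChar, one_mul]
  rw [tendsto_iff_dist_tendsto_zero]
  have hlim : Tendsto (fun n : ℕ => K * ((1 / (n : ℝ)) * truncationError r n)) atTop (𝓝 0) := by
    simpa using (tendsto_truncationError_div hsum).const_mul K
  refine squeeze_zero' (Eventually.of_forall fun _ => dist_nonneg) ?_ hlim
  filter_upwards [eventually_gt_atTop 0] with n hn
  have hn' : (0 : ℝ) < n := by exact_mod_cast hn
  have hpos : (0 : ℝ) < 2 * Real.pi * n := by positivity
  rw [Real.dist_eq]
  refine le_of_mul_le_mul_left ?_ hpos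
  refine le_trans (le_of_eq ?_) ((hbound n).trans_eq ?_)
  · nth_rw 1 [← abs_of_pos hpos]
    rw [← abs_mul]
    congr 1
    field_simp
  · field_simp

end Moments

/-- limiting normalized cumulant generating function of the optimal detector's
statistic under `H₀`.  Let `σ, θ > 0`, let `r : ℤ → ℝ` be a symmetric absolutely summable
unit-variance autocovariance (`r 0 = 1`) with spectral density `f_s(ω) = ∑_k r(k) e^{-ikω}`,
`0 ≤ f_s ≤ M`, and positive semidefinite Toeplitz matrices `Σ_{s,n} = (r(i-j))`.  With
`Qₙ = σ⁻² I - (σ² I + θ² Σ_{s,n})⁻¹` and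
`T_{o,n}(y) = (1/n) [(1/2) log (det(σ² I)/det(σ² I + θ² Σ_{s,n})) + (1/2) yᵀ Qₙ y]`, and
`yₙ ~ N(0, σ² I)` (i.i.d. `N(0,σ²)` coordinates), for every real `t` with
`t θ² M/(σ² + θ² M) < 1`,
`(1/n) log E[exp (n t T_{o,n}(yₙ))] →
  (t/4π) ∫₀^{2π} log (σ²/(σ²+θ² f_s(ω))) dω
    - (1/4π) ∫₀^{2π} log (1 - t θ² f_s(ω)/(σ²+θ² f_s(ω))) dω`. -/
theorem optimal_detector_cgf_H0
    (σ θ : ℝ) (hσ : 0 < σ) (hθ : 0 < θ)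
    (r : ℤ → ℝ) (hr0 : r 0 = 1) (hsymm : ∀ k, r (-k) = r k) (hsum : Summable fun k => |r k|)
    (f : ℝ → ℝ)
    (hf : ∀ ω : ℝ, (f ω : ℂ) = ∑' k : ℤ, (r k : ℂ) * Complex.exp (-Complex.I * k * ω))
    (M : ℝ) (hbound : ∀ ω : ℝ, 0 ≤ f ω ∧ f ω ≤ M)
    (hpsd : ∀ n : ℕ, (Matrix.of fun i j : Fin n => r ((i.val : ℤ) - (j.val : ℤ))).PosSemidef)
    (Q : (n : ℕ) → Matrix (Fin n) (Fin n) ℝ)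
    (hQ : ∀ n : ℕ, Q n = (σ ^ 2)⁻¹ • (1 : Matrix (Fin n) (Fin n) ℝ)
        - (σ ^ 2 • (1 : Matrix (Fin n) (Fin n) ℝ)
            + θ ^ 2 • Matrix.of fun i j : Fin n => r ((i.val : ℤ) - (j.val : ℤ)))⁻¹)
    (T : (n : ℕ) → (Fin n → ℝ) → ℝ)
    (hT : ∀ (n : ℕ) (y : Fin n → ℝ),
        T n y = (1 / (n : ℝ)) * ((1 / 2) * Real.log
            ((σ ^ 2 • (1 : Matrix (Fin n) (Fin n) ℝ)).det
              / (σ ^ 2 • (1 : Matrix (Fin n) (Fin n) ℝ)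
                  + θ ^ 2 • Matrix.of fun i j : Fin n => r ((i.val : ℤ) - (j.val : ℤ))).det)
          + (1 / 2) * (y ⬝ᵥ (Q n).mulVec y)))
    (t : ℝ) (ht : t * θ ^ 2 * M / (σ ^ 2 + θ ^ 2 * M) < 1) :
    Tendsto (fun n : ℕ => (1 / (n : ℝ)) * Real.log (∫ y, Real.exp ((n : ℝ) * t * T n y)
        ∂(Measure.pi fun _ : Fin n => gaussianReal 0 ⟨σ ^ 2, sq_nonneg σ⟩))) atTop
      (𝓝 ((t / (4 * Real.pi)) * (∫ ω in (0 : ℝ)..(2 * Real.pi),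
            Real.log (σ ^ 2 / (σ ^ 2 + θ ^ 2 * f ω)))
        - (1 / (4 * Real.pi)) * ∫ ω in (0 : ℝ)..(2 * Real.pi),
            Real.log (1 - t * θ ^ 2 * f ω / (σ ^ 2 + θ ^ 2 * f ω)))) := by
  have hf' : ∀ ω : ℝ, (f ω : ℂ) = ∑' k : ℤ, (r k : ℂ) * expChar (-k) ω := fun ω => by
    rw [hf]
    refine tsum_congr fun k => ?_
    rw [expChar]
    push_cast
    ring_nf
  have hfc := continuous_symbol hsum hf'
  have hA : ∀ n, (toeplitzMatrix r n).IsHermitian := fun n => (hpsd n).isHermitian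
  have hlam : ∀ n i, (hA n).eigenvalues i ∈ Set.Icc 0 M := fun n i =>
    ⟨(hpsd n).eigenvalues_nonneg i,
      eigenvalues_toeplitzMatrix_le hsum hf' (fun ω => (hbound ω).2) (hA n) i⟩
  have hpos : ∀ x ∈ Set.Icc 0 M, 0 < σ ^ 2 + θ ^ 2 * x := fun x hx => by
    have := hx.1
    positivity
  have hlt : ∀ x ∈ Set.Icc 0 M, 0 < 1 - t * θ ^ 2 * x / (σ ^ 2 + θ ^ 2 * x) := fun x hx => by
    have hM : M ∈ Set.Icc 0 M := ⟨hx.1.trans hx.2, le_rfl⟩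
    rw [div_lt_one (hpos M hM)] at ht
    rw [sub_pos, div_lt_one (hpos x hx)]
    have hσ2 : 0 < σ ^ 2 := by positivity
    have hθx : 0 ≤ θ ^ 2 * x := mul_nonneg (sq_nonneg _) hx.1
    have hθM : θ ^ 2 * x ≤ θ ^ 2 * M := mul_le_mul_of_nonneg_left hx.2 (sq_nonneg _)
    rcases le_total t 1 with h | h <;> nlinarith
  have hL₀ : ContinuousOn (fun x => Real.log (σ ^ 2 / (σ ^ 2 + θ ^ 2 * x))) (Set.Icc 0 M) :=
    (continuousOn_const.div (by fun_prop) fun x hx => (hpos x hx).ne').log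
      fun x hx => (div_pos (by positivity) (hpos x hx)).ne'
  have hL₁ : ContinuousOn (fun x => Real.log (1 - t * θ ^ 2 * x / (σ ^ 2 + θ ^ 2 * x)))
      (Set.Icc 0 M) :=
    (continuousOn_const.sub ((by fun_prop : ContinuousOn (fun x => t * θ ^ 2 * x) _).div
      (by fun_prop) fun x hx => (hpos x hx).ne')).log fun x hx => (hlt x hx).ne'
  have hmom : ∀ k : ℕ, Tendsto (fun n : ℕ => (1 / (n : ℝ)) * ∑ i, (hA n).eigenvalues i ^ k) atTop
      (𝓝 ((1 / (2 * Real.pi)) * ∫ ω in (0 : ℝ)..(2 * Real.pi), f ω ^ k)) := fun k => by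
    simp_rw [← Matrix.IsHermitian.trace_pow_eq_sum_eigenvalues_pow]
    exact tendsto_trace_toeplitzMatrix_pow hsum hf' (M := M)
      (fun ω => by rw [abs_of_nonneg (hbound ω).1]; exact (hbound ω).2) k
  have hlim := tendsto_average_of_tendsto_moments (fun n => (hA n).eigenvalues) hlam hfc hbound
    hmom ((hL₀.const_mul (t / 2)).sub (hL₁.const_mul (1 / 2)))
  simp only [Pi.sub_apply] at hlim
  have hL₀f : Continuous fun ω => Real.log (σ ^ 2 / (σ ^ 2 + θ ^ 2 * f ω)) :=
    hL₀.comp_continuous hfc hbound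
  have hL₁f : Continuous fun ω =>
      Real.log (1 - t * θ ^ 2 * f ω / (σ ^ 2 + θ ^ 2 * f ω)) :=
    hL₁.comp_continuous hfc hbound
  have hval : (1 / (2 * Real.pi)) * (∫ ω in (0 : ℝ)..(2 * Real.pi),
        (t / 2 * Real.log (σ ^ 2 / (σ ^ 2 + θ ^ 2 * f ω))
          - 1 / 2 * Real.log (1 - t * θ ^ 2 * f ω / (σ ^ 2 + θ ^ 2 * f ω))))
      = (t / (4 * Real.pi)) * (∫ ω in (0 : ℝ)..(2 * Real.pi),
            Real.log (σ ^ 2 / (σ ^ 2 + θ ^ 2 * f ω)))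
        - (1 / (4 * Real.pi)) * ∫ ω in (0 : ℝ)..(2 * Real.pi),
            Real.log (1 - t * θ ^ 2 * f ω / (σ ^ 2 + θ ^ 2 * f ω)) := by
    rw [intervalIntegral.integral_sub
      ((hL₀f.intervalIntegrable _ _).const_mul _) ((hL₁f.intervalIntegrable _ _).const_mul _),
      intervalIntegral.integral_const_mul, intervalIntegral.integral_const_mul]
    have := Real.pi_ne_zero
    field_simp
    ring
  rw [← hval]
  refine hlim.congr' ?_
  filter_upwards [eventually_gt_atTop 0] with n hn
  have hn' : (n : ℝ) ≠ 0 := by exact_mod_cast hn.ne'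
  congr 1
  set lam := (hA n).eigenvalues
  have hlamn : ∀ i, lam i ∈ Set.Icc 0 M := hlam n
  have hdet := (hA n).det_smul_one_add_smul (σ ^ 2) (θ ^ 2)
  have hdet₀ : (σ ^ 2 • (1 : Matrix (Fin n) (Fin n) ℝ)).det = ∏ _i : Fin n, σ ^ 2 := by
    simp
  have hratio : Real.log ((σ ^ 2 • (1 : Matrix (Fin n) (Fin n) ℝ)).det
      / (σ ^ 2 • (1 : Matrix (Fin n) (Fin n) ℝ) + θ ^ 2 • toeplitzMatrix r n).det)
      = ∑ i, Real.log (σ ^ 2 / (σ ^ 2 + θ ^ 2 * lam i)) := by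
    rw [hdet, hdet₀, ← Finset.prod_div_distrib,
      Real.log_prod fun i _ => (div_pos (by positivity) (hpos _ (hlamn i))).ne']
  have hunit : IsUnit
      (σ ^ 2 • (1 : Matrix (Fin n) (Fin n) ℝ) + θ ^ 2 • toeplitzMatrix r n).det := by
    rw [hdet, isUnit_iff_ne_zero]
    exact Finset.prod_ne_zero_iff.2 fun i _ => (hpos _ (hlamn i)).ne'
  have hQb : ∀ i, Q n *ᵥ ⇑((hA n).eigenvectorBasis i)
      = ((σ ^ 2)⁻¹ - (σ ^ 2 + θ ^ 2 * lam i)⁻¹) • ⇑((hA n).eigenvectorBasis i) := fun i => by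
    rw [hQ, Matrix.sub_mulVec, Matrix.smul_mulVec, Matrix.one_mulVec,
      Matrix.inv_mulVec_of_eigenvector hunit (hpos _ (hlamn i)).ne', sub_smul]
    rw [Matrix.add_mulVec, Matrix.smul_mulVec, Matrix.smul_mulVec, Matrix.one_mulVec,
      (hA n).mulVec_eigenvectorBasis, smul_smul, add_smul]
  have hq : ∀ i, 1 - 2 * (t / 2) * σ ^ 2 * ((σ ^ 2)⁻¹ - (σ ^ 2 + θ ^ 2 * lam i)⁻¹)
      = 1 - t * θ ^ 2 * lam i / (σ ^ 2 + θ ^ 2 * lam i) := fun i => by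
    have := (hpos _ (hlamn i)).ne'
    field_simp
    ring
  have hint := integral_exp_quadratic_pi_gaussianReal_sq σ (hA n).eigenvectorBasis (Q n) _ (t / 2)
    hQb (fun i => by linarith [hq i, hlt _ (hlamn i)])
  have hexp : ∀ y : Fin n → ℝ, Real.exp ((n : ℝ) * t * T n y)
      = Real.exp (t / 2 * ∑ i, Real.log (σ ^ 2 / (σ ^ 2 + θ ^ 2 * lam i)))
        * Real.exp (t / 2 * (y ⬝ᵥ Q n *ᵥ y)) := fun y => by
    rw [← Real.exp_add, hT, hratio]
    congr 1
    field_simp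
  simp_rw [hexp, integral_const_mul, hint, hq]
  have hsqrt : ∀ i, (√(1 - t * θ ^ 2 * lam i / (σ ^ 2 + θ ^ 2 * lam i)))⁻¹ ≠ 0 := fun i =>
    inv_ne_zero (Real.sqrt_pos.2 (hlt _ (hlamn i))).ne'
  rw [Real.log_mul (Real.exp_pos _).ne' (Finset.prod_ne_zero_iff.2 fun i _ => hsqrt i),
    Real.log_exp, Real.log_prod fun i _ => hsqrt i, Finset.mul_sum,
    ← Finset.sum_add_distrib]
  refine Finset.sum_congr rfl fun i _ => ?_
  rw [Real.log_inv, Real.log_sqrt (hlt _ (hlamn i)).le]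
  ring
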